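/- arXiv:1404.7192 — 3 statements merged into one kernel-verified Lean document; each statement's English description precedes it below -/
import Mathlib

section
/- Let ϖ₁, ϖ₂ ∈ F satisfy 0 < |ϖ₁| ≤ |ϖ₂| < 1 and let I = [|ϖ₁|, |ϖ₂|] ⊆ (0,1). Then the set {x ∈ B^b : |x|_I ≤ 1} of elements of B^b of I-Gauss norm at most 1 is exactly the subring of W(F)[1/p] generated by the image of W(O_F) (under the map of Witt vectors induced by the inclusion O_F ⊆ F) together with the two elements [ϖ₁]·p^{-1} and p·[ϖ₂]^{-1} (where [ϖ₂]^{-1} = [ϖ₂^{-1}]). -/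
open scoped NNReal

/-- The `n`-th coefficient of the Teichmüller expansion `x = Σ [xₙ] pⁿ` of a `p`-typical
Witt vector over a perfect field of characteristic `p`:
`xₙ = (n-th Witt coordinate of x)^(1/pⁿ)`. -/
noncomputable def teichCoeff (p : ℕ) [Fact p.Prime] (F : Type*) [Field F] [CharP F p]
    [PerfectRing F p] (x : WittVector p F) (n : ℕ) : F :=
  (⇑(frobeniusEquiv F p).symm)^[n] (x.coeff n)

namespace WittVector

theorem teichmuller_mem_range_map_integer {p : ℕ} [Fact p.Prime] {F : Type*} [Field F]
    (v : Valuation F ℝ≥0) {a : F} (h : v a ≤ 1) :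
    teichmuller p a ∈ (map (p := p) v.integer.subtype).range :=
  ⟨teichmuller p ⟨a, h⟩, by simp⟩

variable {p : ℕ} [Fact p.Prime] {F : Type*} [Field F] [CharP F p] [PerfectRing F p]

theorem teichCoeff_teichmuller_add_succ (b : F) (z : WittVector p F) (n : ℕ) :
    teichCoeff p F (teichmuller p b + z * p) (n + 1) = teichCoeff p F z n := by
  rw [teichCoeff, coeff_add_of_disjoint]
  · rw [teichmuller_coeff_pos p b _ n.succ_pos, zero_add, mul_charP_coeff_succ,
      Function.iterate_succ_apply, ← _root_.frobenius_def, ← _root_.frobeniusEquiv_apply,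
      RingEquiv.symm_apply_apply, teichCoeff]
  · rintro (_ | m)
    · exact Or.inr (mul_charP_coeff_zero z)
    · exact Or.inl (teichmuller_coeff_pos p b _ m.succ_pos)

theorem exists_eq_teichmuller_add (x : WittVector p F) :
    ∃ z : WittVector p F, x = teichmuller p (teichCoeff p F x 0) + z * p := by
  have h : x - teichmuller p (teichCoeff p F x 0) ∈ Ideal.span {(p : WittVector p F)} := by
    rw [mem_span_p_iff_coeff_zero_eq_zero, ← constantCoeff_apply, map_sub]
    simp [teichCoeff]
  obtain ⟨z, hz⟩ := Ideal.mem_span_singleton.1 h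
  exact ⟨z, by rw [mul_comm, ← hz]; ring⟩

theorem teichCoeff_teichmuller_mul (a : F) (x : WittVector p F) (n : ℕ) :
    teichCoeff p F (teichmuller p a * x) n = a * teichCoeff p F x n := by
  induction n generalizing x with
  | zero => simp [teichCoeff, mul_coeff_zero]
  | succ n ih =>
    obtain ⟨z, hz⟩ := exists_eq_teichmuller_add x
    have h : teichmuller p a * x =
        teichmuller p (a * teichCoeff p F x 0) + (teichmuller p a * z) * p := by
      conv_lhs => rw [hz]
      rw [map_mul]; ring
    rw [h, teichCoeff_teichmuller_add_succ, ih]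
    conv_rhs => rw [hz]
    rw [teichCoeff_teichmuller_add_succ]

theorem teichCoeff_mul_p_pow_add (x : WittVector p F) (k n : ℕ) :
    teichCoeff p F (x * p ^ k) (n + k) = teichCoeff p F x n := by
  induction k with
  | zero => simp
  | succ k ih =>
    rw [pow_succ, ← mul_assoc, ← zero_add (x * p ^ k * p), ← teichmuller_zero p, ← add_assoc,
      teichCoeff_teichmuller_add_succ, ih]

theorem teichCoeff_mul_p_pow_of_lt (x : WittVector p F) {k n : ℕ} (h : n < k) :
    teichCoeff p F (x * p ^ k) n = 0 := by
  rw [teichCoeff, mul_pow_charP_coeff_zero x h, iterate_map_zero]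

theorem teichCoeff_teichmuller_zero (a : F) : teichCoeff p F (teichmuller p a) 0 = a := by
  simp [teichCoeff]

theorem teichCoeff_teichmuller_of_ne_zero (a : F) {n : ℕ} (h : n ≠ 0) :
    teichCoeff p F (teichmuller p a) n = 0 := by
  rw [teichCoeff, teichmuller_coeff_pos p a n (Nat.pos_of_ne_zero h), iterate_map_zero]

theorem exists_eq_sum_teichmuller_add (x : WittVector p F) (N : ℕ) :
    ∃ z : WittVector p F,
      x = ∑ i ∈ Finset.range N, teichmuller p (teichCoeff p F x i) * p ^ i + z * p ^ N ∧
        ∀ n, teichCoeff p F z n = teichCoeff p F x (n + N) := by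
  induction N with
  | zero => exact ⟨x, by simp, by simp⟩
  | succ N ih =>
    obtain ⟨z, hz, hzc⟩ := ih
    obtain ⟨w, hw⟩ := exists_eq_teichmuller_add z
    refine ⟨w, ?_, fun n => ?_⟩
    · rw [Finset.sum_range_succ, ← zero_add N, ← hzc 0, zero_add]
      conv_lhs => rw [hz, hw]
      ring
    · rw [← teichCoeff_teichmuller_add_succ (teichCoeff p F z 0) w n, ← hw, hzc]
      congr 1; ring

theorem teichCoeff_eq_of_dvd_sub {x y : WittVector p F} {N : ℕ}
    (h : (p : WittVector p F) ^ N ∣ x - y) {n : ℕ} (hn : n < N) :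
    teichCoeff p F x n = teichCoeff p F y n := by
  rw [← Ideal.mem_span_singleton, mem_span_p_pow_iff_le_coeff_eq_zero,
    ← le_coeff_eq_iff_le_sub_coeff_eq_zero] at h
  rw [teichCoeff, teichCoeff, h n hn]

variable (v : Valuation F ℝ≥0)

theorem valuation_teichCoeff_le_one_iff (x : WittVector p F) (n : ℕ) :
    v (teichCoeff p F x n) ≤ 1 ↔ v (x.coeff n) ≤ 1 := by
  have h : teichCoeff p F x n ^ p ^ n = x.coeff n := by
    rw [teichCoeff, ← iterateFrobenius_def, coe_iterateFrobenius]
    exact (Function.LeftInverse.iterate (frobenius_apply_frobeniusEquiv_symm F p) n) _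
  rw [← h, map_pow, pow_le_one_iff (pow_ne_zero n (Fact.out : p.Prime).ne_zero)]

theorem mem_range_map_integer_iff (x : WittVector p F) :
    x ∈ (map (p := p) v.integer.subtype).range ↔ ∀ n, v (teichCoeff p F x n) ≤ 1 := by
  simp only [valuation_teichCoeff_le_one_iff]
  constructor
  · rintro ⟨a, rfl⟩ n
    rw [map_coeff]
    exact (a.coeff n).2
  · exact fun h => ⟨mk p fun n => ⟨x.coeff n, h n⟩, by ext n; simp [map_coeff]⟩

theorem exists_integral_dvd_sub {x : WittVector p F} {N : ℕ}
    (hx : ∀ n < N, v (teichCoeff p F x n) ≤ 1) :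
    ∃ a ∈ (map (p := p) v.integer.subtype).range, (p : WittVector p F) ^ N ∣ x - a := by
  obtain ⟨z, hz, -⟩ := exists_eq_sum_teichmuller_add x N
  refine ⟨_, sum_mem fun i hi => mul_mem (teichmuller_mem_range_map_integer v
    (hx i (Finset.mem_range.1 hi))) (pow_mem (natCast_mem _ p) i), z, ?_⟩
  conv_lhs => lhs; rw [hz]
  ring

theorem valuation_teichCoeff_add_le_one {x y : WittVector p F} {N : ℕ}
    (hx : ∀ n < N, v (teichCoeff p F x n) ≤ 1) (hy : ∀ n < N, v (teichCoeff p F y n) ≤ 1) :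
    ∀ n < N, v (teichCoeff p F (x + y) n) ≤ 1 := by
  obtain ⟨a, ha, hxa⟩ := exists_integral_dvd_sub v hx
  obtain ⟨b, hb, hyb⟩ := exists_integral_dvd_sub v hy
  intro n hn
  have h : (p : WittVector p F) ^ N ∣ x + y - (a + b) := by
    rw [add_sub_add_comm]
    exact dvd_add hxa hyb
  rw [teichCoeff_eq_of_dvd_sub h hn]
  exact (mem_range_map_integer_iff v _).1 (add_mem ha hb) n

variable {v} {ϖ : F}

theorem valuation_teichCoeff_add_mul_pow_le_one (hϖ : v ϖ ≤ 1)
    {x y : WittVector p F} {N : ℕ} (hx : ∀ n < N, v (teichCoeff p F x n) * v ϖ ^ n ≤ 1)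
    (hy : ∀ n < N, v (teichCoeff p F y n) * v ϖ ^ n ≤ 1) :
    ∀ n < N, v (teichCoeff p F (x + y) n) * v ϖ ^ n ≤ 1 := by
  intro n hn
  have key : ∀ x : WittVector p F, (∀ n < N, v (teichCoeff p F x n) * v ϖ ^ n ≤ 1) →
      ∀ i < n + 1, v (teichCoeff p F (teichmuller p (ϖ ^ n) * x) i) ≤ 1 := by
    intro x hx i hi
    rw [teichCoeff_teichmuller_mul, map_mul, map_pow, mul_comm]
    exact (mul_le_mul_right (pow_le_pow_of_le_one zero_le hϖ (Nat.lt_succ_iff.1 hi)) _).trans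
      (hx i (by lia))
  have h := valuation_teichCoeff_add_le_one v (key x hx) (key y hy) n n.lt_succ_self
  rwa [← mul_add, teichCoeff_teichmuller_mul, map_mul, map_pow, mul_comm] at h

theorem valuation_teichCoeff_mul_mul_pow_le_one (hϖ : v ϖ ≤ 1) (N : ℕ)
    {x y : WittVector p F} (hx : ∀ n < N, v (teichCoeff p F x n) * v ϖ ^ n ≤ 1)
    (hy : ∀ n < N, v (teichCoeff p F y n) * v ϖ ^ n ≤ 1) :
    ∀ n < N, v (teichCoeff p F (x * y) n) * v ϖ ^ n ≤ 1 := by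
  induction N generalizing x with
  | zero => simp
  | succ N ih =>
    obtain ⟨z, hz⟩ := exists_eq_teichmuller_add x
    have hw := ih (x := teichmuller p ϖ * z) (fun n hn => by
      have := hx (n + 1) (by lia)
      rw [hz, teichCoeff_teichmuller_add_succ] at this
      rw [teichCoeff_teichmuller_mul, map_mul]
      convert! this using 1
      ring) (fun n hn => hy n (by lia))
    rw [hz, add_mul]
    refine valuation_teichCoeff_add_mul_pow_le_one hϖ (fun n hn => ?_) fun n hn => ?_
    · rw [teichCoeff_teichmuller_mul, map_mul, mul_assoc]
      exact mul_le_one' (by simpa using hx 0 N.succ_pos) (hy n hn)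
    · rw [mul_right_comm]
      rcases n with _ | n
      · have := teichCoeff_mul_p_pow_of_lt (z * y) zero_lt_one
        rw [pow_one] at this
        simp [this]
      · have := teichCoeff_mul_p_pow_add (z * y) 1 n
        rw [pow_one] at this
        rw [this]
        have := hw n (by lia)
        rw [mul_assoc, teichCoeff_teichmuller_mul, map_mul] at this
        convert! this using 1
        ring

/-- The Gauss norm of `x` at the radius `v ϖ` is at most `v c`. -/
def GaussNormLE (v : Valuation F ℝ≥0) (ϖ c : F) (x : WittVector p F) : Prop :=
  ∀ n, v (teichCoeff p F x n) * v ϖ ^ n ≤ v c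

namespace GaussNormLE

variable {c d : F} {x y : WittVector p F}

theorem mono (h : GaussNormLE v ϖ c x) (hcd : v c ≤ v d) : GaussNormLE v ϖ d x :=
  fun n => (h n).trans hcd

theorem iff_teichmuller_inv_mul (hc : c ≠ 0) :
    GaussNormLE v ϖ c x ↔ GaussNormLE v ϖ 1 (teichmuller p c⁻¹ * x) := by
  have hv : 0 < v c := (Valuation.pos_iff v).2 hc
  refine forall_congr' fun n => ?_
  rw [teichCoeff_teichmuller_mul, map_mul, map_inv₀, map_one, mul_assoc, inv_mul_le_iff₀ hv,
    mul_one]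

theorem add (hϖ : v ϖ ≤ 1) (hc : c ≠ 0) (hx : GaussNormLE v ϖ c x) (hy : GaussNormLE v ϖ c y) :
    GaussNormLE v ϖ c (x + y) := by
  rw [iff_teichmuller_inv_mul hc] at *
  rw [mul_add]
  simp only [GaussNormLE, map_one] at *
  exact fun n => valuation_teichCoeff_add_mul_pow_le_one hϖ (fun n _ => hx n) (fun n _ => hy n) n
    n.lt_succ_self

theorem mul (hϖ : v ϖ ≤ 1) (hc : c ≠ 0) (hd : d ≠ 0) (hx : GaussNormLE v ϖ c x)
    (hy : GaussNormLE v ϖ d y) : GaussNormLE v ϖ (c * d) (x * y) := by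
  rw [iff_teichmuller_inv_mul hc] at hx
  rw [iff_teichmuller_inv_mul hd] at hy
  rw [iff_teichmuller_inv_mul (mul_ne_zero hc hd), mul_inv, map_mul, mul_mul_mul_comm]
  simp only [GaussNormLE, map_one] at *
  exact fun n => valuation_teichCoeff_mul_mul_pow_le_one hϖ (n + 1) (fun n _ => hx n)
    (fun n _ => hy n) n n.lt_succ_self

theorem mul_p_pow (hx : GaussNormLE v ϖ c x) (k : ℕ) :
    GaussNormLE v ϖ (c * ϖ ^ k) (x * (p : WittVector p F) ^ k) := by
  intro n
  rcases lt_or_ge n k with h | h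
  · simp [teichCoeff_mul_p_pow_of_lt x h]
  · obtain ⟨m, rfl⟩ := Nat.exists_eq_add_of_le' h
    rw [teichCoeff_mul_p_pow_add, map_mul, map_pow, pow_add, ← mul_assoc]
    exact mul_le_mul_left (hx m) _

theorem of_integral (hϖ : v ϖ ≤ 1) (hx : x ∈ (map (p := p) v.integer.subtype).range) :
    GaussNormLE v ϖ 1 x := fun n => by
  rw [map_one]
  exact mul_le_one' ((mem_range_map_integer_iff v x).1 hx n) (pow_le_one' hϖ n)

theorem teichmuller (a : F) : GaussNormLE v ϖ a (teichmuller p a) := by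
  rintro (_ | n)
  · simp [teichCoeff_teichmuller_zero]
  · simp [teichCoeff_teichmuller_of_ne_zero a n.succ_ne_zero]

end GaussNormLE

theorem forall_mem_Icc_teichCoeff_mul_pow_le_iff {ϖ₁ ϖ₂ : F} (hϖ₁ : 0 < v ϖ₁)
    (hϖ₁₂ : v ϖ₁ ≤ v ϖ₂) {k : ℕ} {x : WittVector p F} :
    (∀ ρ ∈ Set.Icc (v ϖ₁) (v ϖ₂), ∀ n : ℕ, v (teichCoeff p F x n) * ρ ^ n ≤ ρ ^ k) ↔
      GaussNormLE v ϖ₁ (ϖ₁ ^ k) x ∧ GaussNormLE v ϖ₂ (ϖ₂ ^ k) x := by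
  constructor
  · exact fun h => ⟨fun n => by simpa using h _ ⟨le_rfl, hϖ₁₂⟩ n,
      fun n => by simpa using h _ ⟨hϖ₁₂, le_rfl⟩ n⟩
  · rintro ⟨h₁, h₂⟩ ρ ⟨hρ₁, hρ₂⟩ n
    rcases le_total n k with h | h <;> obtain ⟨j, rfl⟩ := Nat.exists_eq_add_of_le' h
    · have := h₁ n
      rw [map_pow, pow_add, mul_le_mul_iff_left₀ (pow_pos hϖ₁ n)] at this
      rw [pow_add]
      exact mul_le_mul_left (this.trans (pow_le_pow_left' hρ₁ j)) _
    · have := h₂ (j + k)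
      rw [map_pow, pow_add, ← mul_assoc,
        mul_le_iff_le_one_left (pow_pos (hϖ₁.trans_le hϖ₁₂) k)] at this
      rw [pow_add, ← mul_assoc]
      exact mul_le_of_le_one_left' ((mul_le_mul_right (pow_le_pow_left' hρ₂ j) _).trans this)

/-- The elements `x / p ^ k` of `W(F)[1/p]` with `x` having bounded Teichmüller coefficients and
Gauss norms at most `1` at the radii `v ϖ₁` and `v ϖ₂`. -/
def GaussUnitBall (v : Valuation F ℝ≥0) (ϖ₁ ϖ₂ : F) (y : FractionRing (WittVector p F)) : Prop :=
  ∃ (k : ℕ) (x : WittVector p F),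
    y = algebraMap (WittVector p F) (FractionRing (WittVector p F)) x /
      (p : FractionRing (WittVector p F)) ^ k ∧
    (∃ c : F, c ≠ 0 ∧ GaussNormLE v 1 c x) ∧
    GaussNormLE v ϖ₁ (ϖ₁ ^ k) x ∧ GaussNormLE v ϖ₂ (ϖ₂ ^ k) x

namespace GaussUnitBall

variable {ϖ₁ ϖ₂ : F} {y y' : FractionRing (WittVector p F)}

theorem iff_exists_bounded (hϖ₁ : 0 < v ϖ₁) (hϖ₁₂ : v ϖ₁ ≤ v ϖ₂) (hϖ₁' : v ϖ₁ < 1) :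
    GaussUnitBall v ϖ₁ ϖ₂ y ↔ ∃ (k : ℕ) (x : WittVector p F),
      y = algebraMap (WittVector p F) (FractionRing (WittVector p F)) x /
        (p : FractionRing (WittVector p F)) ^ k ∧
      (∃ C : ℝ≥0, ∀ n : ℕ, v (teichCoeff p F x n) ≤ C) ∧
      (∀ ρ ∈ Set.Icc (v ϖ₁) (v ϖ₂), ∀ n : ℕ, v (teichCoeff p F x n) * ρ ^ n ≤ ρ ^ k) := by
  refine exists_congr fun k => exists_congr fun x => and_congr_right fun _ => and_congr ?_
    (forall_mem_Icc_teichCoeff_mul_pow_le_iff hϖ₁ hϖ₁₂).symm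
  constructor
  · rintro ⟨c, -, h⟩
    exact ⟨v c, fun n => by simpa using h n⟩
  · rintro ⟨C, h⟩
    obtain ⟨m, hm⟩ := pow_unbounded_of_one_lt C ((one_lt_inv₀ hϖ₁).2 hϖ₁')
    refine ⟨ϖ₁⁻¹ ^ m, pow_ne_zero m (inv_ne_zero ((Valuation.pos_iff v).1 hϖ₁)), fun n => ?_⟩
    rw [map_one, one_pow, mul_one, map_pow, map_inv₀]
    exact (h n).trans hm.le

theorem algebraMap_of_integral (hϖ₁ : v ϖ₁ ≤ 1) (hϖ₂ : v ϖ₂ ≤ 1) {x : WittVector p F}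
    (hx : x ∈ (map (p := p) v.integer.subtype).range) :
    GaussUnitBall v ϖ₁ ϖ₂ (algebraMap (WittVector p F) (FractionRing (WittVector p F)) x) :=
  ⟨0, x, by simp, ⟨1, one_ne_zero, .of_integral (by simp) hx⟩,
    by simpa using GaussNormLE.of_integral hϖ₁ hx, by simpa using GaussNormLE.of_integral hϖ₂ hx⟩

theorem teichmuller_div_p (hϖ₁ : 0 < v ϖ₁) (hϖ₁₂ : v ϖ₁ ≤ v ϖ₂) :
    GaussUnitBall v ϖ₁ ϖ₂ (algebraMap (WittVector p F) (FractionRing (WittVector p F))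
      (WittVector.teichmuller p ϖ₁) / (p : FractionRing (WittVector p F))) :=
  ⟨1, WittVector.teichmuller p ϖ₁, by rw [pow_one],
    ⟨ϖ₁, (Valuation.pos_iff v).1 hϖ₁, .teichmuller ϖ₁⟩,
    by simpa using GaussNormLE.teichmuller ϖ₁,
    by simpa using (GaussNormLE.teichmuller ϖ₁).mono hϖ₁₂⟩

theorem p_div_teichmuller (hϖ₁ : 0 < v ϖ₁) (hϖ₁₂ : v ϖ₁ ≤ v ϖ₂) :
    GaussUnitBall v ϖ₁ ϖ₂ ((p : FractionRing (WittVector p F)) /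
      algebraMap (WittVector p F) (FractionRing (WittVector p F))
        (WittVector.teichmuller p ϖ₂)) := by
  have hv : 0 < v ϖ₂ := hϖ₁.trans_le hϖ₁₂
  have h0 : ϖ₂ ≠ 0 := (Valuation.pos_iff v).1 hv
  have h (ϖ : F) : GaussNormLE v ϖ (ϖ₂⁻¹ * ϖ)
      (WittVector.teichmuller p ϖ₂⁻¹ * (p : WittVector p F)) := by
    simpa using (GaussNormLE.teichmuller (p := p) (v := v) (ϖ := ϖ) ϖ₂⁻¹).mul_p_pow 1
  refine ⟨0, WittVector.teichmuller p ϖ₂⁻¹ * p, ?_, ⟨ϖ₂⁻¹ * 1, by simpa using h0, h 1⟩,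
    (h ϖ₁).mono ?_, (h ϖ₂).mono ?_⟩
  · rw [pow_zero, div_one, div_eq_mul_inv, map_mul, map_natCast, mul_comm]
    congr 1
    refine inv_eq_of_mul_eq_one_right ?_
    rw [← map_mul, ← map_mul, mul_inv_cancel₀ h0, map_one, map_one]
  · rw [map_mul, map_inv₀, pow_zero, map_one]
    exact (inv_mul_le_one₀ hv).2 hϖ₁₂
  · rw [inv_mul_cancel₀ h0, pow_zero]

theorem mul (hϖ₁ : 0 < v ϖ₁) (hϖ₁₂ : v ϖ₁ ≤ v ϖ₂) (hϖ₂ : v ϖ₂ ≤ 1)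
    (h : GaussUnitBall v ϖ₁ ϖ₂ y) (h' : GaussUnitBall v ϖ₁ ϖ₂ y') :
    GaussUnitBall v ϖ₁ ϖ₂ (y * y') := by
  have h₁ : ϖ₁ ≠ 0 := (Valuation.pos_iff v).1 hϖ₁
  have h₂ : ϖ₂ ≠ 0 := (Valuation.pos_iff v).1 (hϖ₁.trans_le hϖ₁₂)
  obtain ⟨k, x, rfl, ⟨c, hc, hx⟩, hx₁, hx₂⟩ := h
  obtain ⟨k', x', rfl, ⟨c', hc', hx'⟩, hx'₁, hx'₂⟩ := h'
  refine ⟨k + k', x * x', ?_, ⟨c * c', mul_ne_zero hc hc', hx.mul (by simp) hc hc' hx'⟩,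
    ?_, ?_⟩
  · rw [map_mul, pow_add, div_mul_div_comm]
  · rw [pow_add]
    exact hx₁.mul (hϖ₁₂.trans hϖ₂) (pow_ne_zero _ h₁) (pow_ne_zero _ h₁) hx'₁
  · rw [pow_add]
    exact hx₂.mul hϖ₂ (pow_ne_zero _ h₂) (pow_ne_zero _ h₂) hx'₂

theorem add (hϖ₁ : 0 < v ϖ₁) (hϖ₁₂ : v ϖ₁ ≤ v ϖ₂) (hϖ₂ : v ϖ₂ ≤ 1)
    (h : GaussUnitBall v ϖ₁ ϖ₂ y) (h' : GaussUnitBall v ϖ₁ ϖ₂ y') :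
    GaussUnitBall v ϖ₁ ϖ₂ (y + y') := by
  have h₁ : ϖ₁ ≠ 0 := (Valuation.pos_iff v).1 hϖ₁
  have h₂ : ϖ₂ ≠ 0 := (Valuation.pos_iff v).1 (hϖ₁.trans_le hϖ₁₂)
  have hp := FractionRing.p_nonzero p F
  obtain ⟨k, x, rfl, ⟨c, hc, hx⟩, hx₁, hx₂⟩ := h
  obtain ⟨k', x', rfl, ⟨c', hc', hx'⟩, hx'₁, hx'₂⟩ := h'
  have hx := hx.mul_p_pow k'
  have hx' := hx'.mul_p_pow k
  have hx₁ := hx₁.mul_p_pow k'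
  have hx'₁ := hx'₁.mul_p_pow k
  have hx₂ := hx₂.mul_p_pow k'
  have hx'₂ := hx'₂.mul_p_pow k
  rw [one_pow, mul_one] at hx hx'
  rw [← pow_add] at hx₁ hx₂
  rw [← pow_add, add_comm k' k] at hx'₁ hx'₂
  refine ⟨k + k', x * p ^ k' + x' * p ^ k, ?_, ?_,
    hx₁.add (hϖ₁₂.trans hϖ₂) (pow_ne_zero _ h₁) hx'₁, hx₂.add hϖ₂ (pow_ne_zero _ h₂) hx'₂⟩
  · rw [div_add_div _ _ (pow_ne_zero k hp) (pow_ne_zero k' hp), pow_add]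
    simp [mul_comm]
  · rcases le_total (v c) (v c') with hcc | hcc
    · exact ⟨c', hc', (hx.mono hcc).add (by simp) hc' hx'⟩
    · exact ⟨c, hc, hx.add (by simp) hc (hx'.mono hcc)⟩

theorem of_mem_closure (hϖ₁ : 0 < v ϖ₁) (hϖ₁₂ : v ϖ₁ ≤ v ϖ₂) (hϖ₂ : v ϖ₂ ≤ 1)
    (hy : y ∈ Subring.closure
        (Set.range ((algebraMap (WittVector p F) (FractionRing (WittVector p F))).comp
            (WittVector.map v.integer.subtype)) ∪
          {algebraMap (WittVector p F) (FractionRing (WittVector p F))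
              (WittVector.teichmuller p ϖ₁) / (p : FractionRing (WittVector p F)),
            (p : FractionRing (WittVector p F)) /
              algebraMap (WittVector p F) (FractionRing (WittVector p F))
                (WittVector.teichmuller p ϖ₂)})) :
    GaussUnitBall v ϖ₁ ϖ₂ y := by
  have hi {x : WittVector p F} (hx : x ∈ (map (p := p) v.integer.subtype).range) :=
    algebraMap_of_integral (hϖ₁₂.trans hϖ₂) hϖ₂ hx
  induction hy using Subring.closure_induction with
  | mem y hy =>
    rcases hy with ⟨x, rfl⟩ | rfl | rfl
    · exact hi ⟨x, rfl⟩
    · exact teichmuller_div_p hϖ₁ hϖ₁₂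
    · exact p_div_teichmuller hϖ₁ hϖ₁₂
  | zero => simpa using hi (zero_mem _)
  | one => simpa using hi (one_mem _)
  | add y y' _ _ h h' => exact h.add hϖ₁ hϖ₁₂ hϖ₂ h'
  | neg y _ h => simpa using (hi (neg_mem (one_mem _))).mul hϖ₁ hϖ₁₂ hϖ₂ h
  | mul y y' _ _ h h' => exact h.mul hϖ₁ hϖ₁₂ hϖ₂ h'

theorem mem_of_generators_mem (hϖ₁ : 0 < v ϖ₁) (hϖ₁₂ : v ϖ₁ ≤ v ϖ₂) (hϖ₂ : v ϖ₂ < 1)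
    (A : Subring (FractionRing (WittVector p F)))
    (hA : ∀ x ∈ (map (p := p) v.integer.subtype).range,
      algebraMap (WittVector p F) (FractionRing (WittVector p F)) x ∈ A)
    (hA₁ : algebraMap (WittVector p F) (FractionRing (WittVector p F))
      (WittVector.teichmuller p ϖ₁) / (p : FractionRing (WittVector p F)) ∈ A)
    (hA₂ : (p : FractionRing (WittVector p F)) /
      algebraMap (WittVector p F) (FractionRing (WittVector p F))
        (WittVector.teichmuller p ϖ₂) ∈ A)
    (hy : GaussUnitBall v ϖ₁ ϖ₂ y) : y ∈ A := by
  have h₁ : ϖ₁ ≠ 0 := (Valuation.pos_iff v).1 hϖ₁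
  have hv₂ : 0 < v ϖ₂ := hϖ₁.trans_le hϖ₁₂
  have h₂ : ϖ₂ ≠ 0 := (Valuation.pos_iff v).1 hv₂
  have hp := FractionRing.p_nonzero p F
  have hT : algebraMap (WittVector p F) (FractionRing (WittVector p F))
      (WittVector.teichmuller p ϖ₂) ≠ 0 := by
    rw [map_ne_zero_iff _ (IsFractionRing.injective _ _)]
    intro h
    exact h₂ (by simpa [h] using (teichmuller_coeff_zero p ϖ₂).symm)
  obtain ⟨k, x, rfl, ⟨c, -, hx⟩, hx₁, hx₂⟩ := hy
  obtain ⟨z, hz, hzc⟩ := exists_eq_sum_teichmuller_add x k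
  have hzA : algebraMap (WittVector p F) (FractionRing (WittVector p F)) z ∈ A := by
    have hz₂ (n : ℕ) : v (teichCoeff p F z n) * v ϖ₂ ^ n ≤ 1 := by
      have := hx₂ (n + k)
      rwa [← hzc, map_pow, pow_add, ← mul_assoc, mul_le_iff_le_one_left (pow_pos hv₂ k)] at this
    obtain ⟨m, hm⟩ := pow_unbounded_of_one_lt (v c) ((one_lt_inv₀ hv₂).2 hϖ₂)
    obtain ⟨w, hw, hwc⟩ := exists_eq_sum_teichmuller_add z m
    have hwi : WittVector.teichmuller p (ϖ₂ ^ m) * w ∈ (map (p := p) v.integer.subtype).range := by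
      refine (mem_range_map_integer_iff v _).2 fun n => ?_
      rw [teichCoeff_teichmuller_mul, map_mul, map_pow, hwc, hzc]
      have := (hx (n + m + k)).trans hm.le
      rw [map_one, one_pow, mul_one, inv_pow] at this
      exact (mul_le_mul_right this _).trans (mul_inv_cancel₀ (pow_pos hv₂ m).ne').le
    rw [hw, map_add, map_sum]
    refine add_mem (sum_mem fun i _ => ?_) ?_
    · convert! mul_mem (hA _ (teichmuller_mem_range_map_integer v
        (a := teichCoeff p F z i * ϖ₂ ^ i) (by simpa using hz₂ i))) (pow_mem hA₂ i) using 1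
      simp only [map_mul, map_pow, map_natCast, div_pow]
      field_simp
    · convert! mul_mem (hA _ hwi) (pow_mem hA₂ m) using 1
      simp only [map_mul, map_pow, map_natCast, div_pow]
      field_simp
  rw [hz, map_add, map_sum, add_div, Finset.sum_div]
  refine add_mem (sum_mem fun i hi => ?_) ?_
  · obtain ⟨j, rfl⟩ := Nat.exists_eq_add_of_le' (Finset.mem_range.1 hi).le
    have hi₁ : v (teichCoeff p F x i / ϖ₁ ^ j) ≤ 1 := by
      have := hx₁ i
      rw [map_pow, pow_add, mul_le_mul_iff_left₀ (pow_pos hϖ₁ i)] at this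
      rw [map_div₀, map_pow]
      exact div_le_one_of_le₀ this zero_le
    convert! mul_mem (hA _ (teichmuller_mem_range_map_integer v hi₁)) (pow_mem hA₁ j) using 1
    rw [div_pow, ← map_pow, ← map_pow, mul_div_assoc', ← map_mul, ← map_mul,
      div_mul_cancel₀ _ (pow_ne_zero j h₁), map_mul, map_pow, map_natCast, pow_add]
    field_simp
  · rwa [map_mul, map_pow, map_natCast, mul_div_cancel_right₀ _ (pow_ne_zero k hp)]

end GaussUnitBall

end WittVector

/-- With `I = [|ϖ₁|, |ϖ₂|] ⊆ (0,1)`, the set of elements of `B^b ⊆ W(F)[1/p]`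
of `I`-Gauss norm at most `1` is exactly the subring of `W(F)[1/p]` generated by the image
of `W(O_F)` together with `[ϖ₁]·p⁻¹` and `p·[ϖ₂]⁻¹`.

Here `W(F)[1/p]` is realized as the fraction field of the discrete valuation ring `W(F)`;
an element of `B^b` is `y = x/p^k` with `x ∈ W(F)` having bounded Teichmüller coefficients,
and `|y|_I ≤ 1` means `|xₙ| ρ^n ≤ ρ^k` for all `ρ ∈ I` and all `n`. -/
theorem gaussNormLE_one_eq_closure {p : ℕ} [Fact p.Prime] {F : Type*} [Field F] [CharP F p]
    [PerfectRing F p] (v : Valuation F ℝ≥0)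
    (hv : ∃ y : F, v y ≠ 0 ∧ v y ≠ 1)
    (ϖ₁ ϖ₂ : F) (hϖ₁ : 0 < v ϖ₁) (hϖ₁₂ : v ϖ₁ ≤ v ϖ₂) (hϖ₂ : v ϖ₂ < 1) :
    {y : FractionRing (WittVector p F) |
        ∃ (k : ℕ) (x : WittVector p F),
          y = algebraMap (WittVector p F) (FractionRing (WittVector p F)) x /
                (p : FractionRing (WittVector p F)) ^ k ∧
          (∃ C : ℝ≥0, ∀ n : ℕ, v (teichCoeff p F x n) ≤ C) ∧
          (∀ ρ ∈ Set.Icc (v ϖ₁) (v ϖ₂), ∀ n : ℕ, v (teichCoeff p F x n) * ρ ^ n ≤ ρ ^ k)} =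
      (Subring.closure
        (Set.range ((algebraMap (WittVector p F) (FractionRing (WittVector p F))).comp
            (WittVector.map v.integer.subtype)) ∪
          {algebraMap (WittVector p F) (FractionRing (WittVector p F))
              (WittVector.teichmuller p ϖ₁) / (p : FractionRing (WittVector p F)),
            (p : FractionRing (WittVector p F)) /
              algebraMap (WittVector p F) (FractionRing (WittVector p F))
                (WittVector.teichmuller p ϖ₂)}) : Set (FractionRing (WittVector p F))) := by
  ext y
  rw [Set.mem_ofPred_eq,
    ← WittVector.GaussUnitBall.iff_exists_bounded hϖ₁ hϖ₁₂ (hϖ₁₂.trans_lt hϖ₂), SetLike.mem_coe]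
  refine ⟨WittVector.GaussUnitBall.mem_of_generators_mem hϖ₁ hϖ₁₂ hϖ₂ _ ?_ ?_ ?_,
    WittVector.GaussUnitBall.of_mem_closure hϖ₁ hϖ₁₂ hϖ₂.le⟩
  · rintro _ ⟨x, rfl⟩
    exact Subring.subset_closure (Or.inl ⟨x, rfl⟩)
  · exact Subring.subset_closure (Or.inr (Or.inl rfl))
  · exact Subring.subset_closure (Or.inr (Or.inr rfl))
end

section
/- Assume moreover that B has constant rank d as a projective A-module, i.e., for every prime ideal 𝔭 of A the localization B_𝔭 is a free A_𝔭-module of rank d. Then the tensor square of the top exterior power of B is trivial: there exists an isomorphism of A-modules (⋀^d_A B) ⊗_A (⋀^d_A B) ≅ A. -/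
open TensorProduct

universe u

section LocallyCyclic

variable {R M : Type*} [CommRing R] [AddCommGroup M] [Module R M]

/-- A surjective functional is bijective if, locally and up to denominators, the identity of the
module factors through the base ring. -/
theorem LinearMap.bijective_of_surjective_of_locally_cyclic (g : M →ₗ[R] R)
    (hg : Function.Surjective g)
    (h : ∀ P : Ideal R, P.IsMaximal →
      ∃ s ∉ P, ∃ (c : M →ₗ[R] R) (m : M), ∀ x, s • x = c x • m) :
    Function.Bijective g := by
  refine ⟨(injective_iff_map_eq_zero g).2 fun x hx ↦ ?_, hg⟩
  suffices h1 : (LinearMap.toSpanSingleton R M x).ker = ⊤ by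
    have : (1 : R) ∈ (LinearMap.toSpanSingleton R M x).ker := h1 ▸ Submodule.mem_top
    simpa using this
  by_contra hne
  obtain ⟨P, hP, hle⟩ := Ideal.exists_le_maximal _ hne
  obtain ⟨s, hs, c, m, hc⟩ := h P hP
  obtain ⟨u, hu⟩ := hg 1
  have hcm : c x * g m = 0 := by
    simpa [hx] using (congrArg g (hc x)).symm
  have hs1 : s = c u * g m := by
    simpa [hu] using congrArg g (hc u)
  refine hs (hP.isPrime.mem_of_pow_mem 2 (hle ?_))
  rw [LinearMap.mem_ker, LinearMap.toSpanSingleton_apply, pow_two, mul_smul, hc x, smul_smul,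
    hs1, mul_right_comm, mul_assoc, hcm, mul_zero, zero_smul]

theorem TensorProduct.smul_eq_of_smul_eq {s : R} {c : M →ₗ[R] R} {m : M}
    (h : ∀ x, s • x = c x • m) (t : M ⊗[R] M) :
    (s * s) • t = LinearMap.mul' R R (TensorProduct.map c c t) • m ⊗ₜ[R] m := by
  induction t with
  | zero => simp
  | tmul x y => rw [← smul_tmul_smul, h, h, smul_tmul_smul]; simp
  | add x y hx hy => simp only [smul_add, map_add, hx, hy, add_smul]

theorem TensorProduct.bijective_of_surjective_of_locally_cyclic (g : M ⊗[R] M →ₗ[R] R)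
    (hg : Function.Surjective g)
    (h : ∀ P : Ideal R, P.IsMaximal →
      ∃ s ∉ P, ∃ (c : M →ₗ[R] R) (m : M), ∀ x, s • x = c x • m) :
    Function.Bijective g := by
  refine LinearMap.bijective_of_surjective_of_locally_cyclic g hg fun P hP ↦ ?_
  obtain ⟨s, hs, c, m, hc⟩ := h P hP
  exact ⟨s * s, fun hmem ↦ hs ((hP.isPrime.mem_or_mem hmem).elim id id),
    LinearMap.mul' R R ∘ₗ TensorProduct.map c c, m ⊗ₜ m, TensorProduct.smul_eq_of_smul_eq hc⟩

end LocallyCyclic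

namespace exteriorPower

variable {R M : Type*} [CommRing R] [AddCommGroup M] [Module R M] {n : ℕ}

theorem map_smul_id (r : R) :
    exteriorPower.map n (r • LinearMap.id : M →ₗ[R] M) = r ^ n • LinearMap.id := by
  ext v
  simpa using congrArg Subtype.val ((ιMulti R n).map_smul_univ (fun _ ↦ r) v)

theorem eq_det_smul_ιMulti (b : Module.Basis (Fin n) R M) (x : ⋀[R]^n M) :
    x = alternatingMapLinearEquiv b.det x • ιMulti R n b := by
  suffices LinearMap.id = (alternatingMapLinearEquiv b.det).smulRight (ιMulti R n b) from
    LinearMap.congr_fun this x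
  refine linearMap_ext (b.ext_alternating fun v hv ↦ ?_)
  obtain ⟨σ, rfl⟩ : ∃ σ : Equiv.Perm (Fin n), v = σ :=
    ⟨Equiv.ofBijective v (Finite.injective_iff_bijective.1 hv), rfl⟩
  change ιMulti R n (b ∘ σ) = alternatingMapLinearEquiv b.det (ιMulti R n (b ∘ σ)) • ιMulti R n b
  rw [alternatingMapLinearEquiv_apply_ιMulti, AlternatingMap.map_perm, AlternatingMap.map_perm,
    b.det_self]
  simp

end exteriorPower

section RankOne

variable {A M : Type*} [CommRing A] [AddCommGroup M] [Module A M]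

theorem exists_comp_eq_smul_id_of_localization_free [Module.FinitePresentation A M] {d : ℕ}
    (P : Ideal A) [P.IsPrime]
    (hfree : Module.Free (Localization.AtPrime P) (LocalizedModule P.primeCompl M))
    (hrank : Module.finrank (Localization.AtPrime P) (LocalizedModule P.primeCompl M) = d) :
    ∃ s ∉ P, ∃ (p : M →ₗ[A] (Fin d → A)) (q : (Fin d → A) →ₗ[A] M),
      q ∘ₗ p = s • LinearMap.id ∧ p ∘ₗ q = s • LinearMap.id := by
  let S := P.primeCompl
  let f := LocalizedModule.mkLinearMap S M
  let g : (Fin d → A) →ₗ[A] (Fin d → Localization.AtPrime P) :=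
    LinearMap.pi fun i ↦ Algebra.linearMap A (Localization.AtPrime P) ∘ₗ LinearMap.proj i
  have : IsLocalizedModule S g := inferInstance
  let e : LocalizedModule S M ≃ₗ[A] (Fin d → Localization.AtPrime P) :=
    (Module.finBasisOfFinrankEq _ _ hrank).equivFun.restrictScalars A
  obtain ⟨p, s, hp⟩ := Module.FinitePresentation.exists_lift_of_isLocalizedModule S g
    (e.toLinearMap ∘ₗ f)
  obtain ⟨q, t, hq⟩ := Module.FinitePresentation.exists_lift_of_isLocalizedModule S f
    (e.symm.toLinearMap ∘ₗ g)
  obtain ⟨a, ha⟩ := Module.Finite.exists_smul_of_comp_eq_of_isLocalizedModule S f (q ∘ₗ p)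
    ((t * s) • LinearMap.id) (by
      rw [← LinearMap.comp_assoc, hq, LinearMap.smul_comp, LinearMap.comp_assoc, hp]
      ext x; simp [mul_smul, Submonoid.smul_def])
  obtain ⟨b, hb⟩ := Module.Finite.exists_smul_of_comp_eq_of_isLocalizedModule S g (p ∘ₗ q)
    ((t * s) • LinearMap.id) (by
      rw [← LinearMap.comp_assoc, hp, LinearMap.smul_comp, LinearMap.comp_assoc, hq]
      ext x; simp [mul_smul, Submonoid.smul_def, smul_comm (s : A) (t : A)])
  refine ⟨(a * b * (t * s) : S), (a * b * (t * s)).2, (a * b) • p, q, ?_, ?_⟩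
  · rw [LinearMap.comp_smul, mul_comm a b, mul_smul, ha, smul_smul, smul_smul]; rfl
  · rw [LinearMap.smul_comp, mul_smul, hb, smul_smul, smul_smul]; rfl

/-- An isomorphism of a rank `d` module with its dual trivializes the tensor square of its top
exterior power, through the induced bilinear form. -/
theorem nonempty_exteriorPower_tensor_self_equiv (d : ℕ) (ψ : M ≃ₗ[A] Module.Dual A M)
    (h : ∀ P : Ideal A, P.IsMaximal →
      ∃ s ∉ P, ∃ (p : M →ₗ[A] (Fin d → A)) (q : (Fin d → A) →ₗ[A] M),
        q ∘ₗ p = s • LinearMap.id ∧ p ∘ₗ q = s • LinearMap.id) :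
    Nonempty (((⋀[A]^d M) ⊗[A] (⋀[A]^d M)) ≃ₗ[A] A) := by
  let g : ((⋀[A]^d M) ⊗[A] (⋀[A]^d M)) →ₗ[A] A :=
    TensorProduct.lift (exteriorPower.pairingDual A M d ∘ₗ exteriorPower.map d ψ.toLinearMap)
  suffices hg : Function.Bijective g from ⟨LinearEquiv.ofBijective g hg⟩
  refine TensorProduct.bijective_of_surjective_of_locally_cyclic g ?_ ?_
  · rw [← LinearMap.range_eq_top]
    by_contra hne
    obtain ⟨P, hP, hle⟩ := Ideal.exists_le_maximal _ hne
    obtain ⟨s, hs, p, q, -, hpq⟩ := h P hP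
    let v : Fin d → M := fun i ↦ ψ.symm (LinearMap.proj i ∘ₗ p)
    let b : Fin d → M := fun i ↦ q (Pi.single i 1)
    refine hs (hP.isPrime.mem_of_pow_mem d (hle
      ⟨exteriorPower.ιMulti A d v ⊗ₜ exteriorPower.ιMulti A d b, ?_⟩))
    have hdet : (Matrix.of fun i j ↦ p (b i) j) = s • (1 : Matrix (Fin d) (Fin d) A) := by
      ext i j
      have := congrFun (LinearMap.congr_fun hpq (Pi.single i 1)) j
      simpa [b, Matrix.one_apply, Pi.single_apply, eq_comm] using this
    simp [g, v, hdet, Function.comp_def]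
  · intro P hP
    obtain ⟨s, hs, p, q, hqp, -⟩ := h P hP
    let e := Pi.basisFun A (Fin d)
    have key (x : ⋀[A]^d M) : s ^ d • x =
        (exteriorPower.alternatingMapLinearEquiv e.det ∘ₗ exteriorPower.map d p) x •
          exteriorPower.map d q (exteriorPower.ιMulti A d e) := by
      rw [LinearMap.comp_apply, ← map_smul, ← exteriorPower.eq_det_smul_ιMulti,
        ← LinearMap.comp_apply, ← exteriorPower.map_comp, hqp, exteriorPower.map_smul_id]
      rfl
    exact ⟨s ^ d, fun hmem ↦ hs (hP.isPrime.mem_of_pow_mem _ hmem), _, _, key⟩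

end RankOne

section Trace

variable (A B : Type*) [CommRing A] [CommRing B] [Algebra A B]

open Algebra.FormallyUnramified in
/-- A finite étale algebra is isomorphic to its dual, by the trace form. Since `Algebra.trace` is
only meaningful for free algebras, the trace is built here from a finite dual basis. -/
theorem Algebra.Etale.nonempty_equiv_dual [Algebra.Etale A B] [Module.Finite A B] :
    Nonempty (B ≃ₗ[A] Module.Dual A B) := by
  have := (Module.FinitePresentation.iff_finitePresentation_of_finite A B).2 inferInstance
  have : Module.Projective A B := Module.Flat.projective_of_finitePresentation
  obtain ⟨n, p, q, -, -, hpq⟩ := Module.Finite.exists_comp_eq_id_of_projective A B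
  let b (k : Fin n) : B := p (Pi.single k 1)
  let f (k : Fin n) : Module.Dual A B := LinearMap.proj k ∘ₗ q
  have hb (x : B) : ∑ k, f k x • b k = x := by
    conv_rhs => rw [← LinearMap.id_apply (R := A) x, ← hpq, LinearMap.comp_apply,
      pi_eq_sum_univ' (q x), map_sum]
    simp [b, f]
  let tr : Module.Dual A B := ∑ k, f k ∘ₗ LinearMap.mulLeft A (b k)
  have htr (z : B) : tr z = ∑ k, f k (b k * z) := by simp [tr]
  obtain ⟨S, hS⟩ := TensorProduct.exists_finset (elem A B)
  have hone : ∑ i ∈ S, i.1 * i.2 = 1 := by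
    simpa [hS] using lmul_elem (R := A) (S := B)
  have hmul (c : B) : ∑ i ∈ S, i.1 ⊗ₜ[A] (c * i.2) = ∑ i ∈ S, (c * i.1) ⊗ₜ[A] i.2 := by
    simpa [hS, Finset.mul_sum] using one_tmul_mul_elem (R := A) c
  have hleft (g : Module.Dual A B) (c : B) :
      ∑ i ∈ S, g (c * i.1) • i.2 = c * ∑ i ∈ S, g i.1 • i.2 := by
    simpa [Finset.mul_sum] using
      congrArg ((_root_.TensorProduct.lid A B).toLinearMap ∘ₗ g.rTensor B) (hmul c).symm
  have hright (g : Module.Dual A B) (c : B) :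
      ∑ i ∈ S, g (c * i.2) • i.1 = c * ∑ i ∈ S, g i.2 • i.1 := by
    simpa [Finset.mul_sum] using
      congrArg ((_root_.TensorProduct.rid A B).toLinearMap ∘ₗ g.lTensor B) (hmul c)
  have htr_left : ∑ i ∈ S, tr i.1 • i.2 = 1 := by
    simp_rw [htr, Finset.sum_smul]
    rw [Finset.sum_comm, ← hone]
    simp_rw [hleft, Finset.mul_sum]
    rw [Finset.sum_comm]
    refine Finset.sum_congr rfl fun i _ ↦ ?_
    conv_rhs => rw [← hb i.1, Finset.sum_mul]
    simp
  have htr_right : ∑ i ∈ S, tr i.2 • i.1 = 1 := by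
    simp_rw [htr, Finset.sum_smul]
    rw [Finset.sum_comm, ← hone]
    simp_rw [hright, Finset.mul_sum]
    rw [Finset.sum_comm]
    refine Finset.sum_congr rfl fun i _ ↦ ?_
    conv_rhs => rw [mul_comm, ← hb i.2, Finset.sum_mul]
    simp
  refine ⟨LinearEquiv.ofLinearMap (tr.compRight A ∘ₗ LinearMap.mul A B)
    (∑ i ∈ S, (Module.Dual.eval A B i.1).smulRight i.2) ?_ ?_⟩
  · ext g z
    have h := congrArg g (hright tr z)
    rw [htr_right, mul_one] at h
    simpa [Finset.sum_mul, mul_comm, mul_left_comm] using h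
  · ext c
    simpa [htr_left] using hleft tr c

end Trace

/-- If `B` is a finite étale algebra over a commutative ring `A` which has
constant rank `d` as a projective `A`-module (i.e., for every prime `𝔭` of `A` the
localization `B_𝔭` is a free `A_𝔭`-module of rank `d`), then the tensor square of the top
exterior power of `B` is trivial: `(⋀^d_A B) ⊗_A (⋀^d_A B) ≅ A` as `A`-modules. -/
theorem finiteEtale_topExteriorPower_tensorSquare_trivial (A B : Type u) [CommRing A]
    [CommRing B] [Algebra A B] [Algebra.Etale A B] [Module.Finite A B] (d : ℕ)
    (hrank : ∀ (P : Ideal A) [P.IsPrime],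
      Module.Free (Localization.AtPrime P) (LocalizedModule P.primeCompl B) ∧
        Module.finrank (Localization.AtPrime P) (LocalizedModule P.primeCompl B) = d) :
    Nonempty (((⋀[A]^d B) ⊗[A] (⋀[A]^d B)) ≃ₗ[A] A) := by
  obtain ⟨ψ⟩ := Algebra.Etale.nonempty_equiv_dual A B
  have := (Module.FinitePresentation.iff_finitePresentation_of_finite A B).2 inferInstance
  refine nonempty_exteriorPower_tensor_self_equiv d ψ fun P hP ↦ ?_
  obtain ⟨hfree, hr⟩ := hrank P
  exact exists_comp_eq_smul_id_of_localization_free P hfree hr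
end

section
/- Let p be a prime, let R be a commutative ring of characteristic p that is perfect (the Frobenius endomorphism x ↦ x^p of R is bijective), and let S be a finite étale commutative R-algebra. Then S is perfect: the Frobenius endomorphism x ↦ x^p of S is bijective. -/
universe u

open scoped TensorProduct

/-- In a ring in which the prime `p` vanishes, `p`-th powers are compatible with subtraction. -/
lemma sub_pow_prime_of_natCast_eq_zero {T : Type*} [CommRing T] {p : ℕ} (hp : p.Prime)
    (h : (p : T) = 0) (x y : T) : (x - y) ^ p = x ^ p - y ^ p := by
  obtain ⟨r, hr⟩ := exists_add_pow_prime_eq hp (x - y) y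
  rw [sub_add_cancel, h] at hr
  rw [hr]
  ring

/-- A formally unramified algebra, essentially of finite type and of characteristic `p`, in which
every `p`-th power comes from the base ring is an epimorphism of rings. -/
lemma Algebra.IsEpi.of_formallyUnramified_of_pow_mem_range {A B : Type*} [CommRing A] [CommRing B]
    [Algebra A B] [Algebra.FormallyUnramified A B] [Algebra.EssFiniteType A B] {p : ℕ}
    (hp : p.Prime) (hA : (p : A) = 0) (h : ∀ b : B, b ^ p ∈ Set.range (algebraMap A B)) :
    Algebra.IsEpi A B := by
  have hT : (p : B ⊗[A] B) = 0 := by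
    rw [← map_natCast (algebraMap A (B ⊗[A] B)), hA, map_zero]
  have hnil : IsNilpotent (KaehlerDifferential.ideal A B) := by
    rw [(KaehlerDifferential.ideal_fg A B).isNilpotent_iff_le_nilradical,
      ← KaehlerDifferential.span_range_eq_ideal, Ideal.span_le]
    rintro _ ⟨b, rfl⟩
    refine ⟨p, ?_⟩
    obtain ⟨a, ha⟩ := h b
    simp only [sub_pow_prime_of_natCast_eq_zero hp hT, Algebra.TensorProduct.tmul_pow, one_pow,
      ← ha]
    rw [Algebra.algebraMap_eq_smul_one, TensorProduct.smul_tmul, sub_self]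
    exact Ideal.zero_mem _
  have heq : (Algebra.TensorProduct.includeRight : B →ₐ[A] B ⊗[A] B) =
      Algebra.TensorProduct.includeLeft :=
    Algebra.FormallyUnramified.ext' (Algebra.TensorProduct.lmul' A (S := B) : B ⊗[A] B →+* B)
      hnil _ _ fun x ↦ by simp
  exact (Algebra.isEpi_iff_forall_one_tmul_eq A B).mpr fun b ↦ DFunLike.congr_fun heq b

/-- If `f` and `g.comp f` are étale, so is `g`. -/
lemma RingHom.Etale.of_comp {A B C : Type*} [CommRing A] [CommRing B] [CommRing C]
    {f : A →+* B} {g : B →+* C} (hf : f.Etale) (hgf : (g.comp f).Etale) : g.Etale := by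
  algebraize [f, g, g.comp f]
  exact Algebra.Etale.of_restrictScalars A B C

/-- An étale ring homomorphism in characteristic `p` whose range contains all `p`-th powers is
surjective. -/
lemma RingHom.Etale.surjective_of_pow_mem_range {A B : Type*} [CommRing A] [CommRing B]
    {f : A →+* B} (hf : f.Etale) {p : ℕ} (hp : p.Prime) (hA : (p : A) = 0)
    (h : ∀ b : B, b ^ p ∈ Set.range f) : Function.Surjective f := by
  algebraize [f]
  have : Algebra.IsIntegral A B := ⟨fun b ↦ by
    obtain ⟨a, ha⟩ := h b
    refine IsIntegral.of_pow hp.pos ?_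
    rw [← ha]
    exact isIntegral_algebraMap⟩
  have : Module.Finite A B := Algebra.IsIntegral.finite
  exact Algebra.isEpi_iff_surjective_algebraMap_of_finite.mp
    (.of_formallyUnramified_of_pow_mem_range hp hA h)

/-- A flat Frobenius endomorphism is injective. -/
lemma frobenius_injective_of_flat {S : Type*} [CommRing S] {p : ℕ} [Fact p.Prime] [CharP S p]
    (h : (frobenius S p).Flat) : Function.Injective (frobenius S p) := by
  refine (RingHom.FaithfullyFlat.iff_flat_and_comap_surjective.mpr ⟨h, fun P ↦ ⟨P, ?_⟩⟩).injective
  ext x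
  simp [frobenius_def, P.2.pow_mem_iff_mem p (Fact.out : p.Prime).pos]

/-- Let `p` be a prime, `R` a commutative ring of characteristic `p` whose
Frobenius `x ↦ x^p` is bijective (i.e., `R` is perfect), and `S` a finite étale commutative
`R`-algebra.  Then the Frobenius endomorphism `x ↦ x^p` of `S` is bijective. -/
theorem finiteEtale_perfect_frobenius_bijective (p : ℕ) (hp : p.Prime)
    (R S : Type u) [CommRing R] [CommRing S] [Algebra R S] [CharP R p]
    (hR : Function.Bijective fun x : R => x ^ p)
    [Algebra.Etale R S] [Module.Finite R S] :
    Function.Bijective fun x : S => x ^ p := by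
  rcases subsingleton_or_nontrivial S with _ | _
  · exact ⟨Function.injective_of_subsingleton _, fun x ↦ ⟨x, Subsingleton.elim _ _⟩⟩
  have : Fact p.Prime := ⟨hp⟩
  have hS : (p : S) = 0 := by
    rw [← map_natCast (algebraMap R S), CharP.cast_eq_zero, map_zero]
  have : CharP S p := (CharP.charP_iff_prime_eq_zero hp).mpr hS
  have hRS : (algebraMap R S).Etale := RingHom.etale_algebraMap.mpr inferInstance
  have hcomp : (frobenius S p).comp (algebraMap R S) =
      (algebraMap R S).comp (frobenius R p) := by
    ext x
    simp [frobenius_def]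
  have hF : (frobenius S p).Etale := by
    refine hRS.of_comp ?_
    rw [hcomp]
    exact RingHom.Etale.stableUnderComposition _ _ (.of_bijective hR) hRS
  exact ⟨frobenius_injective_of_flat (RingHom.Etale.iff_flat_and_formallyUnramified.mp hF).1,
    hF.surjective_of_pow_mem_range hp hS fun b ↦ ⟨b, rfl⟩⟩
end
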